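/- Let T be a finitely generated free ℤ-module of odd rank equipped with a nondegenerate symmetric ℤ-valued bilinear form b. Let ω ∈ T ⊗ ℂ satisfy b(ω, ω) = 0 and b(ω, ω̄) > 0 (where ω̄ is the conjugate of ω with respect to the real structure T ⊗ ℝ, and b also denotes the ℂ-bilinear extension of b). Assume moreover that: (i) the only a ∈ T with b(a, ω) = 0 is a = 0; and (ii) b is negative definite on the real subspace {x ∈ T ⊗ ℝ : b(x, ω) = 0}. Then every ℤ-module automorphism h of T satisfying b(h x, h y) = b(x, y) for all x, y ∈ T and whose ℂ-linear extension maps ω into ℂ·ω is equal to id or −id. -/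

import Mathlib

open scoped TensorProduct

/-- Complex conjugation on `ℂ ⊗[ℤ] T`, i.e. conjugation with respect to the real
structure `T ⊗ ℝ`. -/
noncomputable def tensorConj (T : Type) [AddCommGroup T] [Module ℤ T] :
    ℂ ⊗[ℤ] T →ₗ[ℤ] ℂ ⊗[ℤ] T :=
  TensorProduct.map (Complex.conjAe.toLinearMap.restrictScalars ℤ) LinearMap.id

open Matrix in
/-- A square matrix of odd size preserving a nondegenerate bilinear form over a domain of
characteristic different from two has `1` or `-1` as an eigenvalue. -/
theorem Matrix.det_one_sub_eq_zero_or_det_one_add_eq_zero {n R : Type*} [Fintype n]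
    [DecidableEq n] [CommRing R] [IsDomain R] (h2 : (2 : R) ≠ 0) (hn : Odd (Fintype.card n))
    {B M : Matrix n n R} (hB : B.det ≠ 0) (hM : Mᵀ * B * M = B) :
    (1 - M).det = 0 ∨ (1 + M).det = 0 := by
  have hsub : (1 - M)ᵀ * B * M = -(B * (1 - M)) := by
    simp only [transpose_sub, transpose_one, sub_mul, mul_sub, hM, one_mul, mul_one]
    abel
  have hadd : (1 + M)ᵀ * B * M = B * (1 + M) := by
    simp only [transpose_add, transpose_one, add_mul, mul_add, hM, one_mul, mul_one]
    abel
  have dsub := congrArg det hsub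
  have dadd := congrArg det hadd
  simp only [det_mul, det_transpose, det_neg, hn.neg_one_pow] at dsub dadd
  by_contra! hne
  have hp : M.det = -1 := by
    apply mul_left_cancel₀ (mul_ne_zero hne.1 hB)
    linear_combination dsub
  have hm : M.det = 1 := by
    apply mul_left_cancel₀ (mul_ne_zero hne.2 hB)
    linear_combination dadd
  apply h2
  linear_combination hp - hm

/-- An isometry of a nondegenerate bilinear form on a free module of odd rank over a domain of
characteristic different from two fixes or negates some nonzero vector. -/
theorem LinearMap.BilinForm.exists_ne_zero_map_eq_or_map_eq_neg {R M : Type*} [CommRing R]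
    [IsDomain R] [AddCommGroup M] [Module R M] [Module.Free R M] [Module.Finite R M]
    (h2 : (2 : R) ≠ 0) (hrk : Odd (Module.finrank R M)) {b : LinearMap.BilinForm R M}
    (hb : b.Nondegenerate) (h : M →ₗ[R] M) (hpres : ∀ x y, b (h x) (h y) = b x y) :
    ∃ a ≠ 0, h a = a ∨ h a = -a := by
  classical
  let e := Module.Free.chooseBasis R M
  have hdet : (BilinForm.toMatrix e b).det ≠ 0 :=
    (LinearMap.BilinForm.nondegenerate_iff_det_ne_zero e).mp hb
  have hM : (LinearMap.toMatrix e e h).transpose * BilinForm.toMatrix e b *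
      LinearMap.toMatrix e e h = BilinForm.toMatrix e b := by
    rw [← LinearMap.BilinForm.toMatrix_comp (b := e) (c := e)]
    congr 1
    ext x y
    exact hpres x y
  have hcard : Odd (Fintype.card (Module.Free.ChooseBasisIndex R M)) := by
    rwa [← Module.finrank_eq_card_chooseBasisIndex]
  have key : ∀ f : M →ₗ[R] M, (LinearMap.toMatrix e e f).det = 0 → ∃ a ≠ 0, f a = 0 := by
    intro f hf
    rw [LinearMap.det_toMatrix] at hf
    obtain ⟨a, ha, ha0⟩ := (Submodule.ne_bot_iff _).mp (LinearMap.bot_lt_ker_of_det_eq_zero hf).ne'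
    exact ⟨a, ha0, ha⟩
  rcases Matrix.det_one_sub_eq_zero_or_det_one_add_eq_zero h2 hcard hdet hM with hd | hd
  · rw [← LinearMap.toMatrix_one e, ← map_sub] at hd
    obtain ⟨a, ha0, ha⟩ := key _ hd
    exact ⟨a, ha0, .inl (sub_eq_zero.mp ha).symm⟩
  · rw [← LinearMap.toMatrix_one e, ← map_add] at hd
    obtain ⟨a, ha0, ha⟩ := key _ hd
    exact ⟨a, ha0, .inr (eq_neg_of_add_eq_zero_right ha)⟩

theorem LinearMap.BilinForm.baseChange_map_map {R A M : Type*} [CommRing R] [CommRing A]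
    [Algebra R A] [AddCommGroup M] [Module R M] {b : LinearMap.BilinForm R M} {h : M →ₗ[R] M}
    (hpres : ∀ x y, b (h x) (h y) = b x y) (x y : A ⊗[R] M) :
    b.baseChange A (h.baseChange A x) (h.baseChange A y) = b.baseChange A x y := by
  induction x with
  | zero => simp
  | add x₁ x₂ h₁ h₂ => simp [h₁, h₂]
  | tmul r x =>
    induction y with
    | zero => simp
    | add y₁ y₂ h₁ h₂ => simp only [map_add, h₁, h₂]
    | tmul s y => simp [hpres]

/-- Let `T` be a finitely generated free `ℤ`-module of odd rank with a nondegenerate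
symmetric bilinear form `b`, and let `ω ∈ T ⊗ ℂ` satisfy `b(ω, ω) = 0` and
`b(ω, ω̄) > 0`.  Assume (i) the only `a ∈ T` with `b(a, ω) = 0` is `a = 0`, and
(ii) `b` is negative definite on `{x ∈ T ⊗ ℝ : b(x, ω) = 0}` (real vectors being the
conjugation-fixed points of `T ⊗ ℂ`).  Then every isometry `h` of `(T, b)` whose
`ℂ`-linear extension maps `ω` into `ℂ·ω` is `id` or `−id`. -/
theorem stmt_15 (T : Type) [AddCommGroup T] [Module ℤ T]
    [Module.Free ℤ T] [Module.Finite ℤ T]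
    (hrk : Odd (Module.finrank ℤ T))
    (b : LinearMap.BilinForm ℤ T)
    (hbsymm : ∀ x y : T, b x y = b y x)
    (hbnd : ∀ x : T, (∀ y : T, b x y = 0) → x = 0)
    (ω : ℂ ⊗[ℤ] T)
    (hω0 : b.baseChange ℂ ω ω = 0)
    (hωpos : ∃ r : ℝ, 0 < r ∧ b.baseChange ℂ ω (tensorConj T ω) = (r : ℂ))
    (hmin : ∀ a : T, b.baseChange ℂ ((1 : ℂ) ⊗ₜ[ℤ] a) ω = 0 → a = 0)
    (hneg : ∀ x : ℂ ⊗[ℤ] T, tensorConj T x = x → b.baseChange ℂ x ω = 0 → x ≠ 0 →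
      ∃ r : ℝ, r < 0 ∧ b.baseChange ℂ x x = (r : ℂ))
    (h : T ≃ₗ[ℤ] T)
    (hpres : ∀ x y : T, b (h x) (h y) = b x y)
    (hhω : ∃ c : ℂ, h.toLinearMap.baseChange ℂ ω = c • ω) :
    (∀ x : T, h x = x) ∨ (∀ x : T, h x = -x) := by
  obtain ⟨c, hc⟩ := hhω
  have hb : b.Nondegenerate :=
    ⟨hbnd, fun y hy => hbnd y fun x => (hbsymm y x).trans (hy x)⟩
  have hφ (x : T) : c * b.baseChange ℂ (1 ⊗ₜ[ℤ] h x) ω = b.baseChange ℂ (1 ⊗ₜ[ℤ] x) ω := by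
    have := LinearMap.BilinForm.baseChange_map_map (A := ℂ) (h := h.toLinearMap) hpres
      (1 ⊗ₜ[ℤ] x) ω
    simpa [hc] using this
  obtain ⟨a, ha0, ha⟩ := LinearMap.BilinForm.exists_ne_zero_map_eq_or_map_eq_neg
    two_ne_zero hrk hb h.toLinearMap hpres
  have hne : b.baseChange ℂ (1 ⊗ₜ[ℤ] a) ω ≠ 0 := fun h0 => ha0 (hmin a h0)
  have haφ := hφ a
  simp only [LinearEquiv.coe_coe] at ha
  rcases ha with ha | ha
  · left
    rw [ha, mul_eq_right₀ hne] at haφ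
    intro x
    apply sub_eq_zero.mp
    apply hmin
    rw [TensorProduct.tmul_sub, map_sub, LinearMap.sub_apply, ← hφ x, haφ]
    ring
  · right
    rw [ha, TensorProduct.tmul_neg, map_neg, LinearMap.neg_apply, mul_neg, ← neg_mul,
      mul_eq_right₀ hne] at haφ
    intro x
    apply eq_neg_of_add_eq_zero_left
    apply hmin
    rw [TensorProduct.tmul_add, map_add, LinearMap.add_apply, ← hφ x]
    linear_combination -b.baseChange ℂ (1 ⊗ₜ[ℤ] h x) ω * haφ
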